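/- Let H be a finite group, ℋ a separable complex Hilbert space, and α, β : H → U(ℋ) group homomorphisms such that ‖α(h) − β(h)‖ < 1/|H| for all h ∈ H (operator norm). Then there exists a unitary operator u ∈ U(ℋ) with u·α(h)·u⁻¹ = β(h) for all h ∈ H. -/

import Mathlib

section CStarAlgebra

variable {A : Type*} [CStarAlgebra A] [PartialOrder A] [StarOrderedRing A]

/-- The unitary part of the polar decomposition of an invertible element intertwines
every pair of unitaries that the element itself intertwines. -/
theorem IsUnit.exists_unitary_intertwining {a : A} (ha : IsUnit a) :
    ∃ u : unitary A, ∀ v w : unitary A, a * v = w * a → u * v = w * u := by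
  have hs : IsUnit (CFC.abs a) := (CFC.isUnit_sqrt_iff (star a * a)
    (star_mul_self_nonneg a)).2 (ha.star.mul ha)
  have hsa : star (CFC.abs a) = CFC.abs a := (CFC.abs_nonneg a).star_eq
  have habs := CFC.abs_mul_abs a
  have hcomm (v : A) (hv : Commute (star a * a) v) : Commute (CFC.abs a) v :=
    hv.cfcₙ_nnreal _
  generalize CFC.abs a = s at hs hsa habs hcomm
  obtain ⟨s, rfl⟩ := hs
  have hinv : star (↑s⁻¹ : A) = ↑s⁻¹ := by
    rw [← Units.coe_star_inv, show star s = s from Units.ext hsa]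
  have hu : a * ↑s⁻¹ ∈ unitary A := by
    refine (ha.mul s⁻¹.isUnit).mem_unitary_of_star_mul_self ?_
    calc star (a * ↑s⁻¹) * (a * ↑s⁻¹) = ↑s⁻¹ * (star a * a) * ↑s⁻¹ := by
          rw [star_mul, hinv]; simp only [mul_assoc]
      _ = 1 := by rw [← habs]; simp
  refine ⟨⟨_, hu⟩, fun v w h => Subtype.ext ?_⟩
  have h' : star a * w = v * star a := by
    have hvw : star (v : A) * star a = star a * star (w : A) := by
      simpa only [star_mul] using congrArg star h
    calc star a * w = v * (star (v : A) * star a) * w := by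
          rw [← mul_assoc, Unitary.mul_star_self_of_mem v.2, one_mul]
      _ = v * star a := by
          rw [hvw, mul_assoc, mul_assoc, Unitary.star_mul_self_of_mem w.2, mul_one]
  have hv : Commute (s : A) v := hcomm v <| by
    rw [Commute, SemiconjBy, mul_assoc, h, ← mul_assoc, h', mul_assoc]
  calc a * ↑s⁻¹ * (v : A) = a * (v * ↑s⁻¹) := by rw [mul_assoc, hv.units_inv_left.eq]
    _ = w * (a * ↑s⁻¹) := by rw [← mul_assoc, h, mul_assoc]

/-- Two unitary representations of a finite group in a C⋆-algebra that are pointwise at distance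
less than one are unitarily equivalent. -/
theorem exists_unitary_conj_of_norm_sub_lt_one {H : Type*} [Group H] [Finite H]
    (α β : H →* unitary A) (hclose : ∀ h, ‖(α h : A) - β h‖ < 1) :
    ∃ u : unitary A, ∀ h, u * α h * u⁻¹ = β h := by
  have := Fintype.ofFinite H
  have hcard : (0 : ℝ) < Fintype.card H := by exact_mod_cast Fintype.card_pos
  let S : A := ∑ h, (β h : A) * α h⁻¹
  have hS : IsUnit ((Fintype.card H : ℂ)⁻¹ • S) := by
    have hterm (h : H) : ‖1 - (β h : A) * α h⁻¹‖ < 1 := by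
      have : 1 - (β h : A) * α h⁻¹ = (α h - β h) * α h⁻¹ := by
        rw [sub_mul, ← Submonoid.coe_mul _ (α h), ← map_mul]; simp
      rw [this, CStarRing.norm_mul_coe_unitary]
      exact hclose h
    have hsum : 1 - (Fintype.card H : ℂ)⁻¹ • S
        = (Fintype.card H : ℂ)⁻¹ • ∑ h, (1 - (β h : A) * α h⁻¹) := by
      have hne : (Fintype.card H : ℂ) ≠ 0 := by exact_mod_cast hcard.ne'
      rw [Finset.sum_sub_distrib, smul_sub, Finset.sum_const, Finset.card_univ,
        ← Nat.cast_smul_eq_nsmul ℂ, inv_smul_smul₀ hne]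
    rw [← sub_sub_self 1 ((Fintype.card H : ℂ)⁻¹ • S)]
    refine isUnit_one_sub_of_norm_lt_one ?_
    rw [hsum, norm_smul, norm_inv, Complex.norm_natCast, inv_mul_lt_iff₀ hcard, mul_one]
    calc ‖∑ h, (1 - (β h : A) * α h⁻¹)‖ ≤ ∑ h, ‖1 - (β h : A) * α h⁻¹‖ := norm_sum_le _ _
      _ < ∑ _h : H, (1 : ℝ) :=
          Finset.sum_lt_sum_of_nonempty Finset.univ_nonempty fun h _ => hterm h
      _ = Fintype.card H := by simp
  have hint (g : H) : S * α g = β g * S := by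
    simp only [S, Finset.sum_mul, Finset.mul_sum]
    refine (Fintype.sum_equiv (Equiv.mulLeft g) _ _ fun h => ?_).symm
    simp only [Equiv.coe_mulLeft, ← Submonoid.coe_mul, ← map_mul, mul_assoc]
    simp [mul_assoc]
  obtain ⟨u, hu⟩ := hS.exists_unitary_intertwining
  refine ⟨u, fun h => mul_inv_eq_of_eq_mul (hu _ _ ?_)⟩
  rw [smul_mul_assoc, mul_smul_comm, hint]

end CStarAlgebra


/-- Let `H` be a finite group, `𝓗` a separable complex Hilbert space, and
`α, β : H → U(𝓗)` group homomorphisms into the unitary group (with the operator-norm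
topology) such that `‖α(h) − β(h)‖ < 1/|H|` for all `h ∈ H`.  Then there is a unitary
`u ∈ U(𝓗)` with `u·α(h)·u⁻¹ = β(h)` for all `h ∈ H`. -/
theorem unitary_reps_close_implies_conjugate
    {𝓗 : Type*} [NormedAddCommGroup 𝓗] [InnerProductSpace ℂ 𝓗] [CompleteSpace 𝓗]
    [TopologicalSpace.SeparableSpace 𝓗]
    {H : Type*} [Group H] [Finite H]
    (α β : H →* unitary (𝓗 →L[ℂ] 𝓗))
    (hclose : ∀ h : H, ‖((α h : 𝓗 →L[ℂ] 𝓗)) - ((β h : 𝓗 →L[ℂ] 𝓗))‖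
      < 1 / (Nat.card H : ℝ)) :
    ∃ u : unitary (𝓗 →L[ℂ] 𝓗), ∀ h : H, u * α h * u⁻¹ = β h := by
  have hcard : 1 / (Nat.card H : ℝ) ≤ 1 := by
    rw [one_div]
    exact inv_le_one_of_one_le₀ (by exact_mod_cast Nat.card_pos)
  exact exists_unitary_conj_of_norm_sub_lt_one α β fun h => (hclose h).trans_le hcard
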